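/- Let K be a field, let R be a polynomial ring over K in finitely many indeterminates, let t, m, n be integers with 1 ≤ t < m ≤ n, let X be a generic m×n matrix over R, and set B = R[X] and J = I_t(X). Then the supremum over all positive integers k of the projective dimension pd_B(J^k) equals mn − 1. -/

import Mathlib

open Matrix

/-- The ideal generated by the `t × t` minors of a matrix. -/
noncomputable def minorsIdeal {R : Type*} [CommRing R] {α β : Type*}
    (t : ℕ) (A : Matrix α β R) : Ideal R :=
  Ideal.span {d : R | ∃ (f : Fin t → α) (g : Fin t → β),
    Function.Injective f ∧ Function.Injective g ∧ d = (A.submatrix f g).det}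

/-- The height of an ideal: the infimum of the heights of primes containing it. -/
noncomputable def idealHeight {R : Type*} [CommRing R] (I : Ideal R) : ℕ∞ :=
  ⨅ p ∈ {p : PrimeSpectrum R | I ≤ p.asIdeal}, Order.height p

/-- The minimal number of generators of an ideal. -/
noncomputable def mu {R : Type*} [CommRing R] (I : Ideal R) : ℕ :=
  sInf {n : ℕ | ∃ s : Finset R, s.card = n ∧ Ideal.span (s : Set R) = I}

/-- The condition `G_s`. -/
def SatisfiesG {R : Type*} [CommRing R] (I : Ideal R) (s : ℕ) : Prop :=
  ∀ (p : Ideal R) (hp : p.IsPrime), I ≤ p →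
    haveI := hp
    ringKrullDim (Localization.AtPrime p) ≤ ((s - 1 : ℕ) : WithBot ℕ∞) →
    (mu (I.map (algebraMap R (Localization.AtPrime p))) : WithBot ℕ∞) ≤
      ringKrullDim (Localization.AtPrime p)

/-- `pdim R M` is the projective dimension of the `R`-module `M`, as an element of `ℕ∞`
(it is `⊤` if `M` has no finite projective resolution). -/
noncomputable def pdim (R : Type*) [Ring R] (M : Type*) [AddCommGroup M] [Module R M] : ℕ∞ :=
  sInf {n : ℕ∞ | ∃ m : ℕ, n = m ∧
    ∃ P : CategoryTheory.ProjectiveResolution (ModuleCat.of R M),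
      ∀ i : ℕ, m < i → CategoryTheory.Limits.IsZero (P.complex.X i)}

universe u

section ProjectiveDimension

open CategoryTheory Abelian RingTheory.Sequence

section Resolutions

open Limits

universe v u'

variable {C : Type u'} [Category.{v} C] [Abelian C]

lemma CategoryTheory.ProjectiveResolution.hasProjectiveDimensionLE_of_isZero {Z : C}
    (P : ProjectiveResolution Z) (d : ℕ) (hP : ∀ i, d < i → IsZero (P.complex.X i)) :
    HasProjectiveDimensionLE Z d := by
  let _ := HasExt.standard C
  rw [HasProjectiveDimensionLE, hasProjectiveDimensionLT_iff]
  intro i hi Y e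
  obtain ⟨f, hf, rfl⟩ := P.extMk_surjective e (i + 1) rfl
  obtain rfl : f = 0 := (hP i (by omega)).eq_of_src f 0
  exact P.extMk_zero (i + 1) rfl


/-- Short exact sequences `0 ⟶ Y (n + 1) ⟶ P n ⟶ Y n ⟶ 0` with every `P n` projective. -/
structure SyzygyData (C : Type u') [Category.{v} C] [Abelian C] where
  /-- The syzygies. -/
  Y : ℕ → C
  /-- The terms of the resolution. -/
  P : ℕ → C
  /-- The inclusion of the next syzygy. -/
  i : ∀ n, Y (n + 1) ⟶ P n
  /-- The projection to the syzygy. -/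
  p : ∀ n, P n ⟶ Y n
  w : ∀ n, i n ≫ p n = 0
  shortExact : ∀ n, (ShortComplex.mk (i n) (p n) (w n)).ShortExact
  projective : ∀ n, Projective (P n)

namespace SyzygyData

variable (D : SyzygyData C)

/-- The complex obtained by splicing the short exact sequences of `D`. -/
noncomputable abbrev complex : ChainComplex C ℕ :=
  ChainComplex.of D.P (fun n => D.p (n + 1) ≫ D.i n)
    (fun n => by rw [Category.assoc, reassoc_of% (D.w (n + 1)), zero_comp, comp_zero])

lemma complex_d (n : ℕ) : D.complex.d (n + 1) n = D.p (n + 1) ≫ D.i n :=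
  ChainComplex.of_d D.P (fun n => D.p (n + 1) ≫ D.i n) n

lemma exact_comp {A K X Y Y' : C} {i : K ⟶ X} {f : X ⟶ Y} (w : i ≫ f = 0)
    (h : (ShortComplex.mk i f w).Exact) (p : A ⟶ K) [Epi p] (g : Y ⟶ Y') [Mono g] :
    (ShortComplex.mk (p ≫ i) (f ≫ g) (by rw [Category.assoc, reassoc_of% w]; simp)).Exact := by
  let α : ShortComplex.mk (p ≫ i) f (by rw [Category.assoc, w, comp_zero]) ⟶
      ShortComplex.mk i f w :=
    { τ₁ := p
      τ₂ := 𝟙 _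
      τ₃ := 𝟙 _ }
  let β : ShortComplex.mk (p ≫ i) f (by rw [Category.assoc, w, comp_zero]) ⟶
      ShortComplex.mk (p ≫ i) (f ≫ g) (by rw [Category.assoc, reassoc_of% w]; simp) :=
    { τ₁ := 𝟙 _
      τ₂ := 𝟙 _
      τ₃ := g }
  have h1 : Epi α.τ₁ := ‹_›
  have h2 : IsIso α.τ₂ := inferInstanceAs (IsIso (𝟙 _))
  have h3 : Mono α.τ₃ := inferInstanceAs (Mono (𝟙 _))
  have h4 : Epi β.τ₁ := inferInstanceAs (Epi (𝟙 _))
  have h5 : IsIso β.τ₂ := inferInstanceAs (IsIso (𝟙 _))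
  have h6 : Mono β.τ₃ := ‹_›
  rwa [← ShortComplex.exact_iff_of_epi_of_isIso_of_mono β,
    ShortComplex.exact_iff_of_epi_of_isIso_of_mono α]

lemma complex_exactAt_succ (n : ℕ) : D.complex.ExactAt (n + 1) := by
  rw [HomologicalComplex.exactAt_iff' _ (n + 2) (n + 1) n (by simp) (by simp)]
  have := (D.shortExact n).mono_f
  have := (D.shortExact (n + 2)).epi_g
  have h := exact_comp _ (D.shortExact (n + 1)).exact (D.p (n + 2)) (D.i n)
  refine ShortComplex.exact_of_iso ?_ h
  refine ShortComplex.isoMk (Iso.refl _) (Iso.refl _) (Iso.refl _) ?_ ?_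
  · exact (Category.id_comp _).trans ((D.complex_d (n + 1)).trans (Category.comp_id _).symm)
  · exact (Category.id_comp _).trans ((D.complex_d n).trans (Category.comp_id _).symm)

/-- The projective resolution of `D.Y 0` obtained by splicing the short exact sequences of `D`. -/
noncomputable def resolution : ProjectiveResolution (D.Y 0) where
  complex := D.complex
  projective n := D.projective n
  π := (ChainComplex.toSingle₀Equiv _ _).symm ⟨D.p 0, by
    rw [complex_d, Category.assoc, D.w, comp_zero]⟩
  quasiIso := ⟨fun n => by
    cases n with
    | zero =>
      rw [ChainComplex.quasiIsoAt₀_iff, ShortComplex.quasiIso_iff_of_zeros']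
      · have := (D.shortExact 0).epi_g
        have := (D.shortExact 1).epi_g
        have h := exact_comp _ (D.shortExact 0).exact (D.p 1) (𝟙 _)
        refine (ShortComplex.exact_and_epi_g_iff_of_iso ?_).2 ⟨h, by dsimp; infer_instance⟩
        refine ShortComplex.isoMk (Iso.refl _) (Iso.refl _) (Iso.refl _) ?_ ?_
        · exact (Category.id_comp _).trans ((D.complex_d 0).symm.trans (Category.comp_id _).symm)
        · refine (Category.id_comp _).trans (Eq.trans ?_ (Category.comp_id _).symm)
          exact ((ChainComplex.toSingle₀Equiv_symm_apply_f_zero (C := D.complex) _ _).trans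
            (Category.comp_id _).symm).symm
      all_goals rfl
    | succ n =>
      rw [quasiIsoAt_iff_exactAt']
      · apply complex_exactAt_succ
      · apply ChainComplex.exactAt_succ_single_obj⟩

end SyzygyData

variable [EnoughProjectives C]

open Classical in
/-- A projective presentation which is the identity on projective objects. -/
noncomputable def economicalPresentation (Z : C) : ProjectivePresentation Z :=
  if _h : Projective Z then { p := Z, f := 𝟙 Z }
  else Classical.choice (EnoughProjectives.presentation Z)

instance (Z : C) : Projective (economicalPresentation Z).p := (economicalPresentation Z).projective

instance (Z : C) : Epi (economicalPresentation Z).f := (economicalPresentation Z).epi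

lemma isIso_economicalPresentation_f {D : Type u'} [Category.{v} D] [EnoughProjectives D] (Z : D)
    [h : Projective Z] :
    IsIso (economicalPresentation Z).f := by
  unfold economicalPresentation
  rw [dif_pos h]
  infer_instance

/-- The successive syzygies of `Z` for the economical presentations. -/
noncomputable def economicalSyzygy (Z : C) : ℕ → C
  | 0 => Z
  | n + 1 => kernel (economicalPresentation (economicalSyzygy Z n)).f

lemma hasProjectiveDimensionLT_economicalSyzygy (Z : C) (d n : ℕ)
    [HasProjectiveDimensionLT Z d] : HasProjectiveDimensionLT (economicalSyzygy Z n) (d - n) := by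
  induction n with
  | zero => assumption
  | succ n ih =>
    obtain hd | ⟨c, hc⟩ : d - n ≤ 1 ∨ ∃ c, d - n = c + 2 := by
      rcases Nat.lt_or_ge 1 (d - n) with h | h
      · exact .inr ⟨d - n - 2, by omega⟩
      · exact .inl h
    · have : Projective (economicalSyzygy Z n) :=
        projective_iff_hasProjectiveDimensionLT_one.mpr (hasProjectiveDimensionLT_of_ge _ _ 1 hd)
      have := isIso_economicalPresentation_f (economicalSyzygy Z n)
      have h0 : IsZero (economicalSyzygy Z (n + 1)) := isZero_kernel_of_mono _
      have := h0.hasProjectiveDimensionLT_zero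
      exact hasProjectiveDimensionLT_of_ge _ 0 _ (by omega)
    · let f := (economicalPresentation (economicalSyzygy Z n)).f
      let T := ShortComplex.mk (kernel.ι f) f (kernel.condition f)
      have hT : T.ShortExact := { exact := ShortComplex.exact_kernel f }
      rw [hc] at ih
      rw [show d - (n + 1) = c + 1 by omega]
      exact (hT.hasProjectiveDimensionLT_X₃_iff c inferInstance).mp ih

/-- The short exact sequences given by economical presentations. -/
noncomputable def economicalSyzygyData (Z : C) : SyzygyData C where
  Y := economicalSyzygy Z
  P n := (economicalPresentation (economicalSyzygy Z n)).p
  i n := kernel.ι (economicalPresentation (economicalSyzygy Z n)).f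
  p n := (economicalPresentation (economicalSyzygy Z n)).f
  w _ := kernel.condition _
  shortExact n :=
    { exact := ShortComplex.exact_kernel (economicalPresentation (economicalSyzygy Z n)).f
      mono_f := inferInstanceAs (Mono (kernel.ι (economicalPresentation (economicalSyzygy Z n)).f))
      epi_g := (economicalPresentation (economicalSyzygy Z n)).epi }
  projective n := (economicalPresentation (economicalSyzygy Z n)).projective

lemma isZero_economicalSyzygyData_P (Z : C) (d i : ℕ) [HasProjectiveDimensionLE Z d]
    (hi : d < i) : IsZero ((economicalSyzygyData Z).P i) := by
  have h := hasProjectiveDimensionLT_economicalSyzygy Z (d + 1) i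
  rw [show d + 1 - i = 0 by omega] at h
  have h0 := isZero_of_hasProjectiveDimensionLT_zero (economicalSyzygy Z i)
  have := h0.projective
  have h1 := isIso_economicalPresentation_f (economicalSyzygy Z i)
  exact h0.of_iso (@asIso _ _ _ _ _ h1)

end Resolutions

lemma pdim_le_iff {R : Type u} [Ring R] {M : Type u} [AddCommGroup M] [Module R M] (d : ℕ) :
    pdim R M ≤ d ↔ HasProjectiveDimensionLE (ModuleCat.of R M) d := by
  constructor
  · intro h
    obtain ⟨_, ⟨c, rfl, P, hP⟩, hc⟩ :=
      sInf_lt_iff.mp (lt_of_le_of_lt h (by exact_mod_cast Nat.lt_succ_self d : (d : ℕ∞) < (d + 1 : ℕ)))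
    have hcd : c < d + 1 := by exact_mod_cast hc
    exact P.hasProjectiveDimensionLE_of_isZero d fun i hi => hP i (by omega)
  · intro h
    exact sInf_le ⟨d, rfl, (economicalSyzygyData (ModuleCat.of R M)).resolution, fun i hi =>
      isZero_economicalSyzygyData_P _ d i hi⟩

section GradeVanishing

variable {S : Type u} [CommRing S]

/-- If `rs` is weakly regular on `M` and every element of `rs` kills `U`, then `Ext^i(U, M) = 0`
for `i < rs.length`. -/
lemma subsingleton_ext_of_isWeaklyRegular (U : ModuleCat.{u} S) (rs : List S)
    (hU : ∀ r ∈ rs, r • 𝟙 U = 0) (M : ModuleCat.{u} S) (hM : IsWeaklyRegular M rs)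
    (i : ℕ) (hi : i < rs.length) : Subsingleton (Ext U M i) := by
  induction rs generalizing M i with
  | nil => simp at hi
  | cons r rs ih =>
    rw [isWeaklyRegular_cons_iff] at hM
    have hS := hM.1.smulShortComplex_shortExact
    refine subsingleton_of_forall_eq 0 fun e => ?_
    have he : e.comp (Ext.mk₀ (M.smulShortComplex r).f) (add_zero i) = 0 := by
      rw [ModuleCat.smulShortComplex_f_eq_smul_id]
      have h1 := Ext.smul_eq_comp_mk₀ e r
      have h2 : e = (Ext.mk₀ (𝟙 U)).comp e (zero_add i) := by simp
      refine h1.symm.trans ?_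
      rw [h2, ← Ext.smul_comp, ← Ext.mk₀_smul, hU r (by simp), Ext.mk₀_zero, Ext.zero_comp]
      rfl
    cases i with
    | zero =>
      have := hS.mono_f
      apply Ext.postcomp_mk₀_injective_of_mono U (M.smulShortComplex r).f
      exact he.trans (map_zero _).symm
    | succ i =>
      obtain ⟨y, hy⟩ := Ext.covariant_sequence_exact₁ U hS e he rfl
      have := ih (fun s hs => hU s (by simp [hs])) (M.smulShortComplex r).X₃ hM.2 i
        (by simpa using hi)
      rw [← hy, Subsingleton.elim y 0, Ext.zero_comp]
      rfl

/-- Every module of projective dimension at most `d` has `Ext^i(U, M) = 0` for `i + d < rs.length`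
whenever `rs` is weakly regular on the ring and kills `U`. -/
lemma subsingleton_ext_of_hasProjectiveDimensionLE (U : ModuleCat.{u} S) (rs : List S)
    (hU : ∀ r ∈ rs, r • 𝟙 U = 0) (hrs : IsWeaklyRegular S rs) (d : ℕ) (M : ModuleCat.{u} S)
    [hM : HasProjectiveDimensionLE M d] (i : ℕ) (hi : i + d < rs.length) :
    Subsingleton (Ext U M i) := by
  induction d generalizing M i with
  | zero =>
    rw [← projective_iff_hasProjectiveDimensionLE_zero, ← IsProjective.iff_projective] at hM
    have : IsWeaklyRegular M rs :=
      ((TensorProduct.rid S M).isWeaklyRegular_congr rs).mp hrs.isWeaklyRegular_lTensor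
    exact subsingleton_ext_of_isWeaklyRegular U rs hU M this i hi
  | succ d ih =>
    obtain ⟨⟨P, f⟩⟩ := ModuleCat.enoughProjectives.1 M
    let T := ShortComplex.mk (Limits.kernel.ι f) f (Limits.kernel.condition f)
    have hT : T.ShortExact := { exact := ShortComplex.exact_kernel f }
    have hK : HasProjectiveDimensionLE T.X₁ d :=
      (hT.hasProjectiveDimensionLT_X₃_iff d (by assumption)).mp hM
    have hP : HasProjectiveDimensionLE T.X₂ d :=
      hasProjectiveDimensionLT_of_ge T.X₂ 1 (d + 1) (by omega)
    have h1 := ih T.X₁ (i + 1) (by omega)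
    have h2 := ih T.X₂ i (by omega)
    refine subsingleton_of_forall_eq 0 fun e => ?_
    obtain ⟨y, hy⟩ := Ext.covariant_sequence_exact₃ U hT e rfl (Subsingleton.elim _ _)
    rw [← hy, Subsingleton.elim y 0, Ext.zero_comp]

/-- A module containing a nonzero element killed by a weakly regular sequence of length `d + 1`
cannot have projective dimension at most `d`. -/
lemma eq_zero_of_hasProjectiveDimensionLE (rs : List S) (hrs : IsWeaklyRegular S rs) (d : ℕ)
    (hd : d < rs.length) (M : ModuleCat.{u} S) [HasProjectiveDimensionLE M d] (w : M)
    (hw : ∀ r ∈ rs, r • w = 0) : w = 0 := by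
  let U := ModuleCat.of S (S ⧸ Ideal.ofList rs)
  have hU : ∀ r ∈ rs, r • 𝟙 U = 0 := by
    intro r hr
    refine ModuleCat.hom_ext (LinearMap.ext fun x => ?_)
    obtain ⟨y, rfl⟩ := Ideal.Quotient.mk_surjective x
    change r • Ideal.Quotient.mk (Ideal.ofList rs) y = 0
    rw [← Ideal.Quotient.mk_eq_mk, ← Submodule.Quotient.mk_smul, Submodule.Quotient.mk_eq_zero]
    exact Ideal.mul_mem_right _ _ (Ideal.subset_span hr)
  have h0 := subsingleton_ext_of_hasProjectiveDimensionLE U rs hU hrs d M 0 (by omega)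
  have h1 : Subsingleton (U ⟶ M) := Ext.homEquiv₀.subsingleton_congr.mp h0
  have hle : Ideal.ofList rs ≤ LinearMap.ker (LinearMap.toSpanSingleton S M w) :=
    Ideal.span_le.mpr fun r hr => LinearMap.mem_ker.mpr (hw r hr)
  have h2 := congrArg (fun φ : U ⟶ M => φ.hom (Submodule.Quotient.mk 1))
    (Subsingleton.elim (ModuleCat.ofHom (Submodule.liftQ _ _ hle)) 0)
  exact (one_smul S w).symm.trans h2

end GradeVanishing

/-- Distinct variables form a weakly regular sequence in a polynomial ring. -/
lemma MvPolynomial.isWeaklyRegular_map_X {σ R : Type*} [CommRing R] (l : List σ) (hl : l.Nodup) :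
    IsWeaklyRegular (MvPolynomial σ R) (l.map (X : σ → MvPolynomial σ R)) := by
  refine ⟨fun i hi => ?_⟩
  rw [List.length_map] at hi
  have hspan : (Ideal.ofList ((l.map (X : σ → MvPolynomial σ R)).take i) • ⊤ : Submodule (MvPolynomial σ R) _) =
      Ideal.span (X '' {j | j ∈ l.take i}) := by
    rw [smul_eq_mul, Ideal.mul_top, Ideal.ofList]
    congr 1
    ext
    simp only [← List.map_take, List.mem_map, Set.mem_ofPred_eq, Set.mem_image]
  rw [hspan, isSMulRegular_quotient_iff_mem_of_smul_mem]
  intro f hf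
  rw [mem_ideal_span_X_image] at hf ⊢
  intro a ha
  obtain ⟨j, hj, hja⟩ := hf (Finsupp.single l[i] 1 + a) (by
    rw [mem_support_iff] at ha ⊢
    simpa [coeff_X_mul] using ha)
  refine ⟨j, hj, ?_⟩
  have hne : l[i] ≠ j := by
    rintro rfl
    obtain ⟨k, hk, hk'⟩ := List.mem_iff_getElem.mp hj
    rw [List.getElem_take, hl.getElem_inj_iff] at hk'
    simp at hk
    omega
  simpa [Finsupp.single_apply, hne] using hja

section UpperBound

open TensorProduct

/-- The short exact sequence of module categories attached to an exact sequence of modules. -/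
lemma shortExact_of_function_exact {S : Type u} [Ring S] {M N P : Type u} [AddCommGroup M]
    [AddCommGroup N] [AddCommGroup P] [Module S M] [Module S N] [Module S P]
    {f : M →ₗ[S] N} {g : N →ₗ[S] P} (hf : Function.Injective f) (h : Function.Exact f g)
    (hg : Function.Surjective g) :
    (ShortComplex.mk (ModuleCat.ofHom f) (ModuleCat.ofHom g)
      (ModuleCat.hom_ext h.linearMap_comp_eq_zero)).ShortExact where
  exact := (ShortComplex.ShortExact.moduleCat_exact_iff_function_exact _).mpr h
  mono_f := (ModuleCat.mono_iff_injective _).mpr hf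
  epi_g := (ModuleCat.epi_iff_surjective _).mpr hg

/-- The short exact sequence `0 → I → S → S / I → 0`. -/
lemma shortExact_ideal_quotient {S : Type u} [CommRing S] (I : Ideal S) :
    (ShortComplex.mk (ModuleCat.ofHom I.subtype) (ModuleCat.ofHom I.mkQ)
      (ModuleCat.hom_ext (LinearMap.exact_subtype_mkQ I).linearMap_comp_eq_zero)).ShortExact :=
  shortExact_of_function_exact I.injective_subtype (LinearMap.exact_subtype_mkQ I) I.mkQ_surjective

/-- Flat base change preserves short exact sequences. -/
lemma shortExact_baseChange {S : Type u} [CommRing S] (T : Type u) [CommRing T]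
    [Algebra S T] [Module.Flat S T] {M N P : Type u} [AddCommGroup M]
    [AddCommGroup N] [AddCommGroup P] [Module S M] [Module S N] [Module S P]
    {f : M →ₗ[S] N} {g : N →ₗ[S] P} (hf : Function.Injective f) (h : Function.Exact f g)
    (hg : Function.Surjective g) :
    (ShortComplex.mk (ModuleCat.ofHom (f.baseChange T)) (ModuleCat.ofHom (g.baseChange T))
      (by rw [← ModuleCat.ofHom_comp, ← LinearMap.baseChange_comp, h.linearMap_comp_eq_zero,
        LinearMap.baseChange_zero]; rfl)).ShortExact :=
  shortExact_of_function_exact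
    (f := f.baseChange T) (g := g.baseChange T)
    (Module.Flat.lTensor_preserves_injective_linearMap (M := T) f hf)
    (lTensor_exact T h hg) (LinearMap.lTensor_surjective T hg)

/-- Flat base change does not increase the projective dimension. -/
lemma hasProjectiveDimensionLE_baseChange {S : Type u} [CommRing S] (T : Type u) [CommRing T]
    [Algebra S T] [Module.Flat S T] (d : ℕ) (M : Type u) [AddCommGroup M] [Module S M]
    (h : HasProjectiveDimensionLE (ModuleCat.of S M) d) :
    HasProjectiveDimensionLE (ModuleCat.of T (T ⊗[S] M)) d := by
  induction d generalizing M with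
  | zero =>
    rw [← projective_iff_hasProjectiveDimensionLE_zero, ← IsProjective.iff_projective] at h ⊢
    exact Module.Projective.tensorProduct
  | succ d ih =>
    let g := Finsupp.linearCombination S (id : M → M)
    have hg : Function.Surjective g := Finsupp.linearCombination_id_surjective S M
    have hS := LinearMap.shortExact_shortComplexKer hg
    have hT := shortExact_baseChange T (M := LinearMap.ker g) (f := (LinearMap.ker g).subtype) (g := g)
      (LinearMap.ker g).injective_subtype (LinearMap.exact_subtype_ker_map g) hg
    have h1 : Projective (ModuleCat.of S (M →₀ S)) :=
      (IsProjective.iff_projective _).mp inferInstance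
    have h2 : Projective (ModuleCat.of T (T ⊗[S] (M →₀ S))) :=
      (IsProjective.iff_projective _).mp inferInstance
    exact (hT.hasProjectiveDimensionLT_X₃_iff d h2).mpr
      (ih _ ((hS.hasProjectiveDimensionLT_X₃_iff d h1).mp h))

section Polynomial

open Polynomial

/-- An additive predicate on `S[X] ⊗ M` holds as soon as it holds for all `X ^ i ⊗ m`. -/
lemma tensor_X_pow_induction {S : Type*} [CommRing S] {M : Type*} [AddCommGroup M] [Module S M]
    {P : S[X] ⊗[S] M → Prop} (z : S[X] ⊗[S] M)
    (h0 : P 0) (h : ∀ i m, P ((X ^ i : S[X]) ⊗ₜ m))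
    (hadd : ∀ x y, P x → P y → P (x + y)) : P z := by
  induction z using TensorProduct.induction_on with
  | zero => exact h0
  | add x y hx hy => exact hadd x y hx hy
  | tmul p m =>
    induction p using Polynomial.induction_on' with
    | add p q hp hq => rw [TensorProduct.add_tmul]; exact hadd _ _ hp hq
    | monomial i a =>
      rw [← mul_one a, ← smul_eq_mul, ← smul_monomial, ← X_pow_eq_monomial, TensorProduct.smul_tmul]
      exact h i _

variable (S : Type u) [CommRing S] (M : Type u) [AddCommGroup M] [Module S M] [Module S[X] M]
  [IsScalarTower S S[X] M]

/-- Multiplication by `X ⊗ 1 - 1 ⊗ X` on `S[X] ⊗ M`. -/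
noncomputable def tensorXSub : S[X] ⊗[S] M →ₗ[S[X]] S[X] ⊗[S] M :=
  LinearMap.lsmul S[X] _ X - (LinearMap.lsmul S[X] M X |>.restrictScalars S).baseChange S[X]

/-- The action map `S[X] ⊗ M → M`. -/
noncomputable def tensorAct : S[X] ⊗[S] M →ₗ[S[X]] M :=
  AlgebraTensorModule.lift ((LinearMap.lsmul S[X] M : S[X] →ₗ[S[X]] M →ₗ[S[X]] M).restrictScalars₁₂ S[X] S)

/-- The left inverse of `tensorXSub`, sending `X ^ i ⊗ m` to `∑ X ^ j ⊗ X ^ (i - 1 - j) m`. -/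
noncomputable def tensorXSubInv : S[X] ⊗[S] M →ₗ[S] S[X] ⊗[S] M :=
  TensorProduct.lift ((basisMonomials S).constr S fun i => ∑ j ∈ Finset.range i,
    TensorProduct.mk S S[X] M (X ^ j) ∘ₗ (LinearMap.lsmul S[X] M (X ^ (i - 1 - j))).restrictScalars S)

variable {S M}

lemma tensorXSub_tmul (p : S[X]) (m : M) :
    tensorXSub S M (p ⊗ₜ m) = (X * p) ⊗ₜ m - p ⊗ₜ ((X : S[X]) • m) := by
  simp [tensorXSub, TensorProduct.smul_tmul']

lemma tensorAct_tmul (p : S[X]) (m : M) : tensorAct S M (p ⊗ₜ m) = p • m := rfl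

lemma tensorXSubInv_tmul (i : ℕ) (m : M) : tensorXSubInv S M ((X ^ i : S[X]) ⊗ₜ m) =
    ∑ j ∈ Finset.range i, (X ^ j : S[X]) ⊗ₜ[S] ((X ^ (i - 1 - j) : S[X]) • m) := by
  rw [tensorXSubInv, TensorProduct.lift.tmul, X_pow_eq_monomial,
    ← congrFun (coe_basisMonomials (R := S)) i, Module.Basis.constr_basis]
  simp

lemma tensorXSub_injective : Function.Injective (tensorXSub S M) := by
  refine Function.LeftInverse.injective (g := tensorXSubInv S M) fun z => ?_
  induction z using tensor_X_pow_induction with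
  | h0 => simp
  | hadd x y hx hy => rw [map_add, map_add, hx, hy]
  | h i m =>
    rw [tensorXSub_tmul, map_sub, ← pow_succ', tensorXSubInv_tmul, tensorXSubInv_tmul,
      Finset.sum_range_succ, add_comm, add_sub_assoc, ← Finset.sum_sub_distrib,
      Finset.sum_eq_zero, add_zero]
    · simp
    · intro j hj
      rw [Finset.mem_range] at hj
      rw [sub_eq_zero, ← mul_smul, ← pow_succ]
      congr 3
      omega

lemma tensorXSub_exact : Function.Exact (tensorXSub S M) (tensorAct S M) := by
  intro z
  constructor
  · intro hz
    have key : z - 1 ⊗ₜ tensorAct S M z ∈ LinearMap.range (tensorXSub S M) := by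
      clear hz
      induction z using tensor_X_pow_induction with
      | h0 => simp
      | hadd x y hx hy =>
        rw [map_add, TensorProduct.tmul_add, add_sub_add_comm]
        exact add_mem hx hy
      | h i m =>
        rw [tensorAct_tmul]
        induction i generalizing m with
        | zero => simp
        | succ i ih =>
          have := add_mem (LinearMap.mem_range_self (tensorXSub S M) ((X ^ i) ⊗ₜ m))
            (ih ((X : S[X]) • m))
          rwa [tensorXSub_tmul, ← pow_succ', sub_add_sub_cancel, ← mul_smul, ← pow_succ] at this
    rw [hz, TensorProduct.tmul_zero, sub_zero] at key
    exact key
  · rintro ⟨z, rfl⟩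
    induction z using tensor_X_pow_induction with
    | h0 => simp
    | hadd x y hx hy => rw [map_add, map_add, hx, hy, add_zero]
    | h i m => rw [tensorXSub_tmul, map_sub, tensorAct_tmul, tensorAct_tmul, ← mul_smul, mul_comm,
        sub_self]

/-- Passing to a polynomial ring in one variable increases the projective dimension of a module by
at most one. -/
lemma hasProjectiveDimensionLE_polynomial (d : ℕ)
    (h : HasProjectiveDimensionLE (ModuleCat.of S M) d) :
    HasProjectiveDimensionLE (ModuleCat.of S[X] M) (d + 1) := by
  have hF := hasProjectiveDimensionLE_baseChange S[X] d M h
  have hS := shortExact_of_function_exact (tensorXSub_injective (S := S) (M := M)) tensorXSub_exact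
    (fun m => ⟨1 ⊗ₜ m, by rw [tensorAct_tmul, one_smul]⟩)
  exact hS.hasProjectiveDimensionLT_X₃ (d + 1) hF
    (hasProjectiveDimensionLT_of_ge _ (d + 1) (d + 1 + 1) (by omega))

end Polynomial

attribute [local instance] RingHomInvPair.of_ringEquiv in
/-- Transport of projective dimension along a ring isomorphism compatible with the actions. -/
lemma hasProjectiveDimensionLE_of_ringEquiv {S T : Type u} [CommRing S] [CommRing T] (e : S ≃+* T)
    (M : Type u) [AddCommGroup M] [Module S M] [Module T M] (he : ∀ (s : S) (m : M), e s • m = s • m)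
    (d : ℕ) (h : HasProjectiveDimensionLE (ModuleCat.of S M) d) :
    HasProjectiveDimensionLE (ModuleCat.of T M) d :=
  let e' : M ≃ₛₗ[RingHomClass.toRingHom e] M :=
    { AddEquiv.refl M with map_smul' := fun s m => (he s m).symm }
  ModuleCat.hasProjectiveDimensionLE_of_semiLinearEquiv (M := ModuleCat.of S M)
    (N := ModuleCat.of T M) e e' d

/-- Passing to a polynomial ring in `n` variables increases the projective dimension of a module by
at most `n`. -/
lemma hasProjectiveDimensionLE_mvPolynomial_fin {S : Type u} [CommRing S] (d : ℕ)
    (M : Type u) [AddCommGroup M] [Module S M]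
    (h : HasProjectiveDimensionLE (ModuleCat.of S M) d) (n : ℕ) :
    ∀ [Module (MvPolynomial (Fin n) S) M] [IsScalarTower S (MvPolynomial (Fin n) S) M],
      HasProjectiveDimensionLE (ModuleCat.of (MvPolynomial (Fin n) S) M) (d + n) := by
  induction n with
  | zero =>
    intro _ _
    refine hasProjectiveDimensionLE_of_ringEquiv
      (MvPolynomial.isEmptyAlgEquiv S (Fin 0)).symm.toRingEquiv M (fun s m => ?_) d h
    change MvPolynomial.C s • m = s • m
    rw [← MvPolynomial.algebraMap_eq, algebraMap_smul]
  | succ n ih =>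
    intro _ _
    let e := MvPolynomial.finSuccEquiv S n
    let _ : Module (Polynomial (MvPolynomial (Fin n) S)) M :=
      Module.compHom M e.symm.toRingEquiv.toRingHom
    let _ : Module (MvPolynomial (Fin n) S) M := Module.compHom M Polynomial.C
    have : IsScalarTower (MvPolynomial (Fin n) S) (Polynomial (MvPolynomial (Fin n) S)) M :=
      ⟨fun a p m => by rw [Polynomial.smul_eq_C_mul, mul_smul]; rfl⟩
    have : IsScalarTower S (MvPolynomial (Fin n) S) M := by
      refine ⟨fun a p m => ?_⟩
      rw [MvPolynomial.smul_eq_C_mul, mul_smul]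
      change e.symm (Polynomial.C (MvPolynomial.C a)) • p • m = _
      have : e.symm (Polynomial.C (MvPolynomial.C a)) = MvPolynomial.C a := by
        rw [AlgEquiv.symm_apply_eq]
        simp [e, MvPolynomial.finSuccEquiv_apply]
      rw [this, ← MvPolynomial.algebraMap_eq, algebraMap_smul]
    exact hasProjectiveDimensionLE_of_ringEquiv e.symm.toRingEquiv M (fun s m => rfl) _
      (hasProjectiveDimensionLE_polynomial _ ih)

/-- Passing to a polynomial ring in finitely many variables increases the projective dimension of a
module by at most the number of variables. -/
lemma hasProjectiveDimensionLE_mvPolynomial {S : Type u} [CommRing S] (σ : Type) [Fintype σ]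
    (d : ℕ) (M : Type u) [AddCommGroup M] [Module S M] [Module (MvPolynomial σ S) M]
    [IsScalarTower S (MvPolynomial σ S) M]
    (h : HasProjectiveDimensionLE (ModuleCat.of S M) d) :
    HasProjectiveDimensionLE (ModuleCat.of (MvPolynomial σ S) M) (d + Fintype.card σ) := by
  let e := MvPolynomial.renameEquiv S (Fintype.equivFin σ).symm
  let _ : Module (MvPolynomial (Fin (Fintype.card σ)) S) M :=
    Module.compHom M e.toRingEquiv.toRingHom
  have : IsScalarTower S (MvPolynomial (Fin (Fintype.card σ)) S) M := by
    refine ⟨fun a p m => ?_⟩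
    change e (a • p) • m = a • e p • m
    rw [map_smul, smul_assoc]
  exact hasProjectiveDimensionLE_of_ringEquiv e.toRingEquiv M (fun s m => rfl) _
    (hasProjectiveDimensionLE_mvPolynomial_fin d M h _)

attribute [local instance] MvPolynomial.algebraMvPolynomial in
/-- An ideal of a polynomial ring in `N + 1` variables extended from a field of coefficients has
projective dimension at most `N`. -/
lemma hasProjectiveDimensionLE_ideal_map (K R : Type u) [Field K] [CommRing R] [Algebra K R]
    (σ : Type) [Fintype σ] (N : ℕ) (hN : Fintype.card σ = N + 1) (I : Ideal (MvPolynomial σ K)) :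
    HasProjectiveDimensionLE (ModuleCat.of (MvPolynomial σ R)
      (I.map (MvPolynomial.map (σ := σ) (algebraMap K R)))) N := by
  let A := MvPolynomial σ K
  let B := MvPolynomial σ R
  have h0 : HasProjectiveDimensionLE (ModuleCat.of K (A ⧸ I)) 0 := by
    rw [← projective_iff_hasProjectiveDimensionLE_zero, ← IsProjective.iff_projective]
    infer_instance
  have h1 := hasProjectiveDimensionLE_mvPolynomial σ 0 (A ⧸ I) h0
  have : Module.Flat A B := Module.Flat.isBaseChange K A R B
    (Algebra.IsPushout.out (R := K) (S := A) (R' := R) (S' := B))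
  have h2 := hasProjectiveDimensionLE_baseChange B _ (A ⧸ I) h1
  have h3 := ModuleCat.hasProjectiveDimensionLE_of_linearEquiv
    (M := ModuleCat.of B (B ⊗[A] (A ⧸ I))) (N := ModuleCat.of B (B ⧸ I.map (algebraMap A B)))
    (I.qoutMapEquivTensorQout B).symm (0 + Fintype.card σ)
  rw [zero_add, hN] at h3
  exact ((shortExact_ideal_quotient _).hasProjectiveDimensionLT_X₃_iff N
    ((IsProjective.iff_projective _).mp inferInstance)).mp h3

end UpperBound

end ProjectiveDimension

section Minors

variable {S : Type*} [CommRing S]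

lemma det_submatrix_mem_minorsIdeal {α β : Type*} {t : ℕ} (A : Matrix α β S) {f : Fin t → α}
    {g : Fin t → β} (hf : Function.Injective f) (hg : Function.Injective g) :
    (A.submatrix f g).det ∈ minorsIdeal t A :=
  Ideal.subset_span ⟨f, g, hf, hg, rfl⟩

lemma minorsIdeal_map {T α β : Type*} [CommRing T] (φ : S →+* T) (t : ℕ) (A : Matrix α β S) :
    (minorsIdeal t A).map φ = minorsIdeal t (A.map φ) := by
  rw [minorsIdeal, minorsIdeal, Ideal.map_span]
  congr 1
  ext d
  constructor
  · rintro ⟨_, ⟨f, g, hf, hg, rfl⟩, rfl⟩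
    exact ⟨f, g, hf, hg, φ.map_det _⟩
  · rintro ⟨f, g, hf, hg, rfl⟩
    exact ⟨_, ⟨f, g, hf, hg, rfl⟩, φ.map_det _⟩

/-- The determinant of a matrix with entries in `I` lies in the power of `I` given by its size. -/
lemma det_mem_pow {ι : Type*} [Fintype ι] [DecidableEq ι] {I : Ideal S} (A : Matrix ι ι S)
    (hA : ∀ i j, A i j ∈ I) : A.det ∈ I ^ Fintype.card ι := by
  rw [det_apply]
  refine sum_mem fun σ _ => ?_
  have h : ∏ i, A (σ i) i ∈ ∏ _i : ι, I := Ideal.prod_mem_prod fun i _ => hA _ _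
  rw [Finset.prod_const, Finset.card_univ] at h
  exact zsmul_mem h _

lemma adjugate_mem {t : ℕ} {I : Ideal S} (A : Matrix (Fin (t + 1)) (Fin (t + 1)) S)
    (hA : minorsIdeal t A ≤ I) (i j : Fin (t + 1)) : A.adjugate i j ∈ I := by
  rw [adjugate_fin_succ_eq_det_submatrix]
  exact I.mul_mem_left _ (hA (det_submatrix_mem_minorsIdeal A Fin.succAbove_right_injective
    Fin.succAbove_right_injective))

lemma det_pow_mem {t : ℕ} {I : Ideal S} (A : Matrix (Fin (t + 1)) (Fin (t + 1)) S)
    (hA : minorsIdeal t A ≤ I) : A.det ^ t ∈ I ^ (t + 1) := by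
  have h := det_mem_pow A.adjugate (adjugate_mem A hA)
  rwa [det_adjugate, Fintype.card_fin, Nat.add_sub_cancel] at h

lemma mul_det_pow_mem {s : ℕ} {I : Ideal S} (A : Matrix (Fin (s + 2)) (Fin (s + 2)) S)
    (hA : minorsIdeal (s + 1) A ≤ I) (i j : Fin (s + 2)) : A i j * A.det ^ s ∈ I ^ (s + 1) := by
  have h : A.adjugate.adjugate i j ∈ I ^ (s + 1) := by
    rw [adjugate_fin_succ_eq_det_submatrix]
    have := det_mem_pow (A.adjugate.submatrix j.succAbove i.succAbove)
      fun _ _ => adjugate_mem A hA _ _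
    rw [Fintype.card_fin] at this
    exact Ideal.mul_mem_left _ _ this
  rw [adjugate_adjugate A (by simp), Fintype.card_fin] at h
  rwa [mul_comm]

end Minors

section GenericMatrix

variable {m n : ℕ} {R : Type*} [CommRing R]

lemma det_submatrix_mvPolynomialX {t : ℕ} (f : Fin t → Fin m) (g : Fin t → Fin n) :
    ((mvPolynomialX (Fin m) (Fin n) R).submatrix f g).det =
      MvPolynomial.rename (Prod.map f g) (mvPolynomialX (Fin t) (Fin t) R).det := by
  rw [AlgHom.map_det]
  congr 1
  ext i j : 2
  simp

lemma det_submatrix_mvPolynomialX_ne_zero [Nontrivial R] {t : ℕ} {f : Fin t → Fin m}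
    {g : Fin t → Fin n} (hf : Function.Injective f) (hg : Function.Injective g) :
    ((mvPolynomialX (Fin m) (Fin n) R).submatrix f g).det ≠ 0 := by
  rw [det_submatrix_mvPolynomialX, Ne, map_eq_zero_iff _
    (MvPolynomial.rename_injective _ (hf.prodMap hg))]
  exact det_mvPolynomialX_ne_zero _ _

lemma isHomogeneous_det_submatrix_mvPolynomialX {t : ℕ} (f : Fin t → Fin m) (g : Fin t → Fin n) :
    ((mvPolynomialX (Fin m) (Fin n) R).submatrix f g).det.IsHomogeneous t := by
  rw [det_apply]
  refine MvPolynomial.IsHomogeneous.sum _ _ _ fun σ _ => ?_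
  have h : (∏ i, (mvPolynomialX (Fin m) (Fin n) R).submatrix f g (σ i) i).IsHomogeneous
      (∑ _i : Fin t, 1) :=
    MvPolynomial.IsHomogeneous.prod _ _ _ fun i _ => MvPolynomial.isHomogeneous_X _ _
  rw [Finset.sum_const, Finset.card_univ, Fintype.card_fin, smul_eq_mul, mul_one] at h
  exact zsmul_mem (show _ ∈ MvPolynomial.homogeneousSubmodule _ R t from h) _

lemma minorsIdeal_mvPolynomialX_pow_le (t k : ℕ) :
    minorsIdeal t (mvPolynomialX (Fin m) (Fin n) R) ^ k ≤
      MvPolynomial.idealOfVars (Fin m × Fin n) R ^ (t * k) := by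
  rw [pow_mul]
  refine Ideal.pow_right_mono (Ideal.span_le.mpr ?_) k
  rintro _ ⟨f, g, -, -, rfl⟩
  have h := det_mem_pow (I := MvPolynomial.idealOfVars (Fin m × Fin n) R)
    ((mvPolynomialX (Fin m) (Fin n) R).submatrix f g)
    fun i j => Ideal.subset_span ⟨(f i, g j), rfl⟩
  rwa [Fintype.card_fin] at h

lemma exists_injective_apply_zero_eq {t : ℕ} (h : t + 1 ≤ m) (i : Fin m) :
    ∃ f : Fin (t + 1) → Fin m, Function.Injective f ∧ f 0 = i :=
  ⟨Equiv.swap (Fin.castLE h 0) i ∘ Fin.castLE h,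
    (Equiv.injective _).comp (Fin.castLE_injective h), by simp⟩

/-- Some power of the ideal of `(s + 1)`-minors of a generic matrix of larger size has an element
outside of it which is multiplied into it by a power of every variable. -/
lemma exists_notMem_pow_minorsIdeal [IsDomain R] (s : ℕ) (hm : s + 2 ≤ m) (hn : s + 2 ≤ n) :
    ∃ k, 0 < k ∧ ∃ F : MvPolynomial (Fin m × Fin n) R,
      F ∉ minorsIdeal (s + 1) (mvPolynomialX (Fin m) (Fin n) R) ^ k ∧
      ∀ p, MvPolynomial.X p ^ (s + 1) * F ∈
        minorsIdeal (s + 1) (mvPolynomialX (Fin m) (Fin n) R) ^ k := by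
  set J := minorsIdeal (s + 1) (mvPolynomialX (Fin m) (Fin n) R)
  choose f hf hf0 using exists_injective_apply_zero_eq (t := s + 1) hm
  choose g hg hg0 using exists_injective_apply_zero_eq (t := s + 1) hn
  let A : Fin m × Fin n → Matrix (Fin (s + 2)) (Fin (s + 2)) (MvPolynomial (Fin m × Fin n) R) :=
    fun p => (mvPolynomialX (Fin m) (Fin n) R).submatrix (f p.1) (g p.2)
  have hA : ∀ p, minorsIdeal (s + 1) (A p) ≤ J := by
    intro p
    refine Ideal.span_le.mpr ?_
    rintro _ ⟨f', g', hf', hg', rfl⟩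
    exact det_submatrix_mem_minorsIdeal _ ((hf p.1).comp hf') ((hg p.2).comp hg')
  let a : Fin m × Fin n → MvPolynomial (Fin m × Fin n) R := fun p => ((A p).det ^ (s + 1)) ^ s
  have ha : ∀ p, a p ∈ J ^ ((s + 2) * s) := fun p => by
    rw [pow_mul]
    exact Ideal.pow_mem_pow (det_pow_mem (A p) (hA p)) s
  have hxa : ∀ p, MvPolynomial.X p ^ (s + 1) * a p ∈ J ^ ((s + 2) * s + 1) := fun p => by
    have h := Ideal.pow_mem_pow (mul_det_pow_mem (A p) (hA p) 0 0) (s + 1)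
    have h0 : A p 0 0 = MvPolynomial.X p := by simp [A, hf0, hg0]
    rw [h0, mul_pow, ← pow_mul, ← pow_mul] at h
    rw [show (s + 2) * s + 1 = (s + 1) * (s + 1) by ring]
    simpa only [a, ← pow_mul, mul_comm (s + 1) s] using h
  refine ⟨m * n * ((s + 2) * s) + 1, by omega, ∏ p, a p, ?_, ?_⟩
  · intro hF
    have h0 : ∏ p, a p ≠ 0 := Finset.prod_ne_zero_iff.mpr fun p _ =>
      pow_ne_zero _ (pow_ne_zero _ (det_submatrix_mvPolynomialX_ne_zero (hf _) (hg _)))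
    have hhom : (∏ p, a p).IsHomogeneous (∑ _p : Fin m × Fin n, (s + 2) * (s + 1) * s) :=
      MvPolynomial.IsHomogeneous.prod _ _ _ fun p _ =>
        ((isHomogeneous_det_submatrix_mvPolynomialX _ _).pow _).pow _
    obtain ⟨d, hd⟩ := MvPolynomial.ne_zero_iff.mp h0
    have hdeg : Finsupp.degree d = ∑ _p : Fin m × Fin n, (s + 2) * (s + 1) * s :=
      (DFunLike.congr_fun Finsupp.degree_eq_weight_one d).trans (hhom hd)
    rw [Finset.sum_const, Finset.card_univ, Fintype.card_prod,
      Fintype.card_fin, Fintype.card_fin, smul_eq_mul] at hdeg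
    refine hd ((MvPolynomial.mem_pow_idealOfVars_iff' _ _).mp
      (minorsIdeal_mvPolynomialX_pow_le _ _ hF) d ?_)
    rw [hdeg, show (s + 1) * (m * n * ((s + 2) * s) + 1) =
      m * n * ((s + 2) * (s + 1) * s) + (s + 1) by ring]
    omega
  · intro p
    rw [← Finset.mul_prod_erase _ _ (Finset.mem_univ p)]
    have h := Ideal.prod_mem_prod (I := fun _ => J ^ ((s + 2) * s)) (s := Finset.univ.erase p)
      (x := a) fun q _ => ha q
    rw [Finset.prod_const, Finset.card_erase_of_mem (Finset.mem_univ p), Finset.card_univ,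
      Fintype.card_prod, Fintype.card_fin, Fintype.card_fin, ← pow_mul] at h
    have h' := Ideal.mul_mem_mul (hxa p) h
    rw [← pow_add, mul_assoc (MvPolynomial.X p ^ (s + 1))] at h'
    suffices hexp : m * n * ((s + 2) * s) + 1 = (s + 2) * s + 1 + (s + 2) * s * (m * n - 1) by
      rwa [hexp]
    obtain ⟨N, hN⟩ : ∃ N, m * n = N + 1 :=
      ⟨m * n - 1, (Nat.sub_add_cancel (Nat.mul_pos (by omega) (by omega))).symm⟩
    rw [hN, Nat.add_sub_cancel]
    ring

end GenericMatrix

/-- If every scalar in a finite family has a power killing a nonzero element, then a nonzero multiple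
of this element is killed by all of them. -/
lemma exists_ne_zero_smul_eq_zero {S M ι : Type*} [CommRing S] [AddCommGroup M] [Module S M]
    (x : ι → S) (e : ℕ) (v : M) (hv : v ≠ 0) (hx : ∀ i, x i ^ e • v = 0) (s : Finset ι) :
    ∃ c : S, c • v ≠ 0 ∧ ∀ i ∈ s, x i • c • v = 0 := by
  classical
  induction s using Finset.induction_on with
  | empty => exact ⟨1, by simpa using hv, by simp⟩
  | insert i s _ ih =>
    obtain ⟨c, hc, hcs⟩ := ih
    have hex : ∃ k, x i ^ k • c • v = 0 := ⟨e, by rw [smul_comm, hx, smul_zero]⟩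
    obtain ⟨k, hk⟩ : ∃ k, Nat.find hex = k + 1 :=
      Nat.exists_eq_succ_of_ne_zero fun h => hc (by simpa [h] using Nat.find_spec hex)
    refine ⟨x i ^ k * c, ?_, fun j hj => ?_⟩
    · rw [mul_smul]
      exact Nat.find_min hex (by omega)
    · rw [mul_smul]
      obtain rfl | hj := Finset.mem_insert.mp hj
      · rw [← mul_smul, ← pow_succ', ← hk]
        exact Nat.find_spec hex
      · rw [smul_comm, hcs j hj, smul_zero]

open CategoryTheory in
/-- The lower bound for the projective dimension of a power of the ideal of minors. -/
lemma exists_not_hasProjectiveDimensionLE_pow_minorsIdeal {R : Type u} [CommRing R] [IsDomain R]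
    {m n : ℕ} (s N : ℕ) (hm : s + 2 ≤ m) (hn : s + 2 ≤ n) (hN : N + 2 = m * n) :
    ∃ k, 0 < k ∧ ¬ HasProjectiveDimensionLE (ModuleCat.of (MvPolynomial (Fin m × Fin n) R)
      ↥(minorsIdeal (s + 1) (mvPolynomialX (Fin m) (Fin n) R) ^ k)) N := by
  obtain ⟨k, hk, F, hF, hXF⟩ := exists_notMem_pow_minorsIdeal (R := R) s hm hn
  refine ⟨k, hk, fun h => ?_⟩
  set I := minorsIdeal (s + 1) (mvPolynomialX (Fin m) (Fin n) R) ^ k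
  have hquot := ((shortExact_ideal_quotient I).hasProjectiveDimensionLT_X₃_iff N
    ((IsProjective.iff_projective _).mp inferInstance)).mpr h
  obtain ⟨c, hc, hXc⟩ := exists_ne_zero_smul_eq_zero (MvPolynomial.X (R := R)) (s + 1) (I.mkQ F)
    (fun h0 => hF ((Submodule.Quotient.mk_eq_zero I).mp h0))
    (fun p => by
      rw [← map_smul]
      exact (Submodule.Quotient.mk_eq_zero I).mpr (hXF p)) Finset.univ
  have hreg := MvPolynomial.isWeaklyRegular_map_X (R := R)
    (Finset.univ : Finset (Fin m × Fin n)).toList (Finset.nodup_toList _)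
  refine hc (@eq_zero_of_hasProjectiveDimensionLE _ _ _ hreg (N + 1) ?_ _ hquot (c • I.mkQ F) ?_)
  · rw [List.length_map, Finset.length_toList, Finset.card_univ, Fintype.card_prod,
      Fintype.card_fin, Fintype.card_fin]
    omega
  · intro r hr
    obtain ⟨p, -, rfl⟩ := List.mem_map.mp hr
    exact hXc p (Finset.mem_univ p)

lemma minorsIdeal_mvPolynomialX_pow_eq_map (K : Type*) {R : Type*} [CommRing K] [CommRing R]
    [Algebra K R] (m n t k : ℕ) : minorsIdeal t (mvPolynomialX (Fin m) (Fin n) R) ^ k =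
      (minorsIdeal t (mvPolynomialX (Fin m) (Fin n) K) ^ k).map
        (MvPolynomial.map (algebraMap K R)) := by
  rw [Ideal.map_pow, minorsIdeal_map]
  congr 2
  ext i j : 2
  simp

theorem statement_9 (K : Type*) [Field K] (e : ℕ)
    (t m n : ℕ) (h1t : 1 ≤ t) (htm : t < m) (hmn : m ≤ n) :
    let R := MvPolynomial (Fin e) K
    let B := MvPolynomial (Fin m × Fin n) R
    let X : Matrix (Fin m) (Fin n) B := Matrix.of fun i j => MvPolynomial.X (i, j)
    let J : Ideal B := minorsIdeal t X
    (⨆ k : ℕ, ⨆ _ : 0 < k, pdim B ↥(J ^ k)) = ((m * n - 1 : ℕ) : ℕ∞) := by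
  intro R B X J
  obtain ⟨s, rfl⟩ : ∃ s, t = s + 1 := ⟨t - 1, by omega⟩
  obtain ⟨N, hN⟩ : ∃ N, N + 2 = m * n :=
    ⟨m * n - 2, Nat.sub_add_cancel (Nat.mul_le_mul (by omega : 2 ≤ m) (by omega : 1 ≤ n))⟩
  rw [← hN, show N + 2 - 1 = N + 1 by omega]
  apply le_antisymm
  · refine iSup₂_le fun k _ => (pdim_le_iff _).mpr ?_
    have h : J ^ k = _ := minorsIdeal_mvPolynomialX_pow_eq_map K (R := R) m n (s + 1) k
    rw [h]
    exact hasProjectiveDimensionLE_ideal_map K R (Fin m × Fin n) (N + 1)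
      (by rw [Fintype.card_prod, Fintype.card_fin, Fintype.card_fin, ← hN]) _
  · obtain ⟨k, hk, hpd⟩ := exists_not_hasProjectiveDimensionLE_pow_minorsIdeal (R := R) s N
      (by omega) (by omega) hN
    refine le_trans ?_ (le_iSup₂ k hk)
    rw [← pdim_le_iff, not_le] at hpd
    exact_mod_cast Order.add_one_le_of_lt hpd
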